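/- arXiv:1711.01367 — 2 statements merged into one kernel-verified Lean document; each statement's English description precedes it below -/
import Mathlib

section
/- Let x ∈ H1 and ŷ, y ∈ H2, and set û := A x + B ŷ − c and ŝ := û − P_K(û). Then ψ(x, y) ≤ ψ(x, ŷ) + ⟨B* ŝ, y − ŷ⟩ + (‖B‖²/2) ‖y − ŷ‖², where B* is the adjoint of B and ‖B‖ is the operator norm of B. -/
open scoped RealInnerProductSpace

/-- The variational inequality characterizing the projection `p` of `u` onto `K` identifies
the distance from `u` to `K`. -/
theorem infDist_eq_norm_sub_of_inner_nonpos {E : Type*} [NormedAddCommGroup E]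
    [InnerProductSpace ℝ E] {K : Set E} {u p : E} (hp : p ∈ K)
    (h : ∀ w ∈ K, ⟪u - p, w - p⟫ ≤ 0) : Metric.infDist u K = ‖u - p‖ := by
  refine le_antisymm ((Metric.infDist_le_dist_of_mem hp).trans_eq (dist_eq_norm u p)) ?_
  refine (Metric.le_infDist ⟨p, hp⟩).2 fun w hw => ?_
  rw [dist_eq_norm]
  refine (sq_le_sq₀ (norm_nonneg _) (norm_nonneg _)).1 ?_
  have hsq := norm_sub_sq_real (u - p) (w - p)
  rw [sub_sub_sub_cancel_right] at hsq
  nlinarith [h w hw, sq_nonneg ‖w - p‖]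

/-- Partial descent bound for `ψ(x,y) := (1/2) dist_K(A x + B y − c)²`
in the `y` variable: with `û := A x + B ŷ − c` and `ŝ := û − P_K(û)`,
`ψ(x, y) ≤ ψ(x, ŷ) + ⟪B* ŝ, y − ŷ⟫ + (‖B‖²/2)‖y − ŷ‖²`. -/
theorem stmt_5
    {H1 H2 H : Type*}
    [NormedAddCommGroup H1] [InnerProductSpace ℝ H1] [CompleteSpace H1]
    [NormedAddCommGroup H2] [InnerProductSpace ℝ H2] [CompleteSpace H2]
    [NormedAddCommGroup H] [InnerProductSpace ℝ H] [CompleteSpace H]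
    (A : H1 →L[ℝ] H) (B : H2 →L[ℝ] H) (c : H) (K : Set H)
    (hKne : K.Nonempty) (hKcl : IsClosed K) (hKcv : Convex ℝ K)
    (x : H1) (yh y : H2) (p : H)
    (hp : p ∈ K) (hpproj : ∀ w ∈ K, ⟪(A x + B yh - c) - p, w - p⟫ ≤ 0) :
    (1/2) * Metric.infDist (A x + B y - c) K ^ 2 ≤
      (1/2) * Metric.infDist (A x + B yh - c) K ^ 2
        + ⟪ContinuousLinearMap.adjoint B ((A x + B yh - c) - p), y - yh⟫
        + (‖B‖ ^ 2 / 2) * ‖y - yh‖ ^ 2 := by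
  rw [infDist_eq_norm_sub_of_inner_nonpos hp hpproj, ContinuousLinearMap.adjoint_inner_left]
  have hdist : Metric.infDist (A x + B y - c) K ≤ ‖(A x + B yh - c - p) + B (y - yh)‖ := by
    refine (Metric.infDist_le_dist_of_mem hp).trans_eq ?_
    rw [dist_eq_norm, map_sub]
    congr 1
    abel
  have hdist_sq := pow_le_pow_left₀ Metric.infDist_nonneg hdist 2
  have hB := pow_le_pow_left₀ (norm_nonneg _) (B.le_opNorm (y - yh)) 2
  rw [mul_pow] at hB
  rw [norm_add_sq_real] at hdist_sq
  linarith
end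

section
/- (Convergence of Algorithm 2 / PAPA for semi-strongly convex problems, Option 1.) Let (x*, y*, λ*) be a saddle-point datum with optimal value F*, let g be μ_g-strongly convex with μ_g > 0, and assume B ≠ 0. Fix γ₀ ≥ 0 and ρ₀ ∈ (0, μ_g/(2‖B‖²)]. Define τ₀ := 1, τ_{k+1} := (τ_k/2)(√(τ_k² + 4) − τ_k), and ρ_k := ρ₀/τ_k². Let sequences satisfy x̂⁰ = x⁰, ỹ⁰ = y⁰, and for every k ≥ 0: ŷ^k := (1−τ_k)y^k + τ_k ỹ^k; there is a subgradient ξ_k of f at x^{k+1} with ξ_k + ρ_k A* ŝ^{k+1} + γ₀ (x^{k+1} − x̂^k) = 0, where ŝ^{k+1} := (A x^{k+1} + B ŷ^k − c) − P_K(A x^{k+1} + B ŷ^k − c); x̂^{k+1} := x^{k+1} + (τ_{k+1}(1−τ_k)/τ_k)(x^{k+1} − x^k); there is η_k with η_k + ρ_k B* ŝ^{k+1} + τ_k ρ_k ‖B‖² (ỹ^{k+1} − ỹ^k) = 0 and g(y) ≥ g(ỹ^{k+1}) + ⟨η_k, y − ỹ^{k+1}⟩ + (μ_g/2)‖y − ỹ^{k+1}‖²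 for all y; and y^{k+1} := (1−τ_k)y^k + τ_k ỹ^{k+1}. Then for every k ≥ 1: |F(x^k, y^k) − F*| ≤ 2 max{ρ₀ R_p², 2‖λ*‖ R_d} / (ρ₀ (k+1)²) and dist_K(A x^k + B y^k − c) ≤ 4 R_d / (ρ₀ (k+1)²), where R_p² := γ₀‖x⁰ − x*‖² + ρ₀‖B‖²‖y⁰ − y*‖² and R_d := ‖λ*‖ + √(‖λ*‖² + ρ₀ R_p²). -/
open scoped RealInnerProductSpace

section ProjectionResidual

variable {H : Type*} [NormedAddCommGroup H] [InnerProductSpace ℝ H] {K : Set H} {P : H → H}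

/-- The residual `u ↦ u - P u` is the gradient of the convex, 1-smooth function
`½ dist_K²`, which yields the strengthened gradient inequality. -/
theorem proj_residual_gradient_lower (hPmem : ∀ u, P u ∈ K)
    (hPproj : ∀ u, ∀ w ∈ K, ⟪u - P u, w - P u⟫ ≤ 0) (u v : H) :
    ‖u - P u‖ ^ 2 + 2 * ⟪u - P u, v - u⟫ + ‖(v - P v) - (u - P u)‖ ^ 2 ≤ ‖v - P v‖ ^ 2 := by
  have h := hPproj u (P v) (hPmem v)
  have e1 : P v - P u = (v - u) - (v - P v) + (u - P u) := by abel
  rw [e1, inner_add_right, inner_sub_right, real_inner_self_eq_norm_sq] at h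
  rw [norm_sub_sq_real (v - P v) (u - P u), real_inner_comm (u - P u)]
  linarith

/-- Descent inequality for `½ dist_K²`. -/
theorem proj_residual_gradient_upper (hPmem : ∀ u, P u ∈ K)
    (hPproj : ∀ u, ∀ w ∈ K, ⟪u - P u, w - P u⟫ ≤ 0) (u v : H) :
    ‖v - P v‖ ^ 2 ≤ ‖u - P u‖ ^ 2 + 2 * ⟪u - P u, v - u⟫ + ‖v - u‖ ^ 2 := by
  have h := hPproj v (P u) (hPmem u)
  have e1 : ‖(u - P u) + (v - u)‖ ^ 2 = ‖(v - P v) - (P u - P v)‖ ^ 2 := by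
    congr 2; abel
  rw [norm_add_sq_real, norm_sub_sq_real (v - P v) (P u - P v)] at e1
  nlinarith [sq_nonneg ‖P u - P v‖]

theorem proj_residual_inner_le (hPproj : ∀ u, ∀ w ∈ K, ⟪u - P u, w - P u⟫ ≤ 0)
    (u : H) {w : H} (hw : w ∈ K) : ⟪u - P u, w - u⟫ ≤ -‖u - P u‖ ^ 2 := by
  have h := hPproj u w hw
  have e1 : w - P u = (w - u) + (u - P u) := by abel
  rw [e1, inner_add_right, real_inner_self_eq_norm_sq] at h
  linarith

theorem mul_norm_sq_le_convex_combination (t : ℝ) (p q : H) :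
    (1 - t) * t * ‖p‖ ^ 2 ≤ (1 - t) * ‖p - q‖ ^ 2 + t * ‖q‖ ^ 2 := by
  have h : ‖(1 - t) • p - q‖ ^ 2 = (1 - t) ^ 2 * ‖p‖ ^ 2 - 2 * ((1 - t) * ⟪p, q⟫) + ‖q‖ ^ 2 := by
    rw [norm_sub_sq_real, norm_smul, real_inner_smul_left, mul_pow, Real.norm_eq_abs, sq_abs]
  rw [norm_sub_sq_real]
  nlinarith [sq_nonneg ‖(1 - t) • p - q‖]

theorem two_mul_inner_sub_sub (a b z : H) :
    2 * ⟪a - b, a - z⟫ = ‖a - z‖ ^ 2 + ‖a - b‖ ^ 2 - ‖b - z‖ ^ 2 := by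
  have e : b - z = (a - z) - (a - b) := by abel
  rw [e, norm_sub_sq_real (a - z) (a - b), real_inner_comm]
  ring

end ProjectionResidual

section StepSizes

variable {τ : ℕ → ℝ}

theorem stepsize_pos_le_one (hτ0 : τ 0 = 1)
    (hτrec : ∀ k : ℕ, τ (k + 1) = τ k / 2 * (Real.sqrt (τ k ^ 2 + 4) - τ k)) (k : ℕ) :
    0 < τ k ∧ τ k ≤ 1 := by
  induction k with
  | zero => simp [hτ0]
  | succ k ih =>
    obtain ⟨h0, h1⟩ := ih
    have hs := Real.sq_sqrt (show 0 ≤ τ k ^ 2 + 4 by positivity)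
    have hs0 := Real.sqrt_nonneg (τ k ^ 2 + 4)
    rw [hτrec]
    constructor
    · have : τ k < Real.sqrt (τ k ^ 2 + 4) := by nlinarith
      have : 0 < Real.sqrt (τ k ^ 2 + 4) - τ k := by linarith
      positivity
    · have : Real.sqrt (τ k ^ 2 + 4) ≤ τ k + 2 := by nlinarith
      nlinarith

theorem stepsize_sq
    (hτrec : ∀ k : ℕ, τ (k + 1) = τ k / 2 * (Real.sqrt (τ k ^ 2 + 4) - τ k)) (k : ℕ) :
    τ (k + 1) ^ 2 = (1 - τ (k + 1)) * τ k ^ 2 := by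
  have hs := Real.sq_sqrt (show 0 ≤ τ k ^ 2 + 4 by positivity)
  rw [hτrec]
  linear_combination τ k ^ 2 / 4 * hs

theorem stepsize_le_two_mul_succ (hτ0 : τ 0 = 1)
    (hτrec : ∀ k : ℕ, τ (k + 1) = τ k / 2 * (Real.sqrt (τ k ^ 2 + 4) - τ k)) (k : ℕ) :
    τ k ≤ 2 * τ (k + 1) := by
  obtain ⟨h0, h1⟩ := stepsize_pos_le_one hτ0 hτrec k
  have hs := Real.sq_sqrt (show 0 ≤ τ k ^ 2 + 4 by positivity)
  have hs0 := Real.sqrt_nonneg (τ k ^ 2 + 4)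
  have : τ k + 1 ≤ Real.sqrt (τ k ^ 2 + 4) := by nlinarith
  rw [hτrec]
  nlinarith

theorem stepsize_mul_le_two (hτ0 : τ 0 = 1)
    (hτrec : ∀ k : ℕ, τ (k + 1) = τ k / 2 * (Real.sqrt (τ k ^ 2 + 4) - τ k)) (k : ℕ) :
    τ k * ((k : ℝ) + 2) ≤ 2 := by
  induction k with
  | zero => simp [hτ0]
  | succ k ih =>
    obtain ⟨h0, -⟩ := stepsize_pos_le_one hτ0 hτrec k
    obtain ⟨h2, h3⟩ := stepsize_pos_le_one hτ0 hτrec (k + 1)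
    have hsq := stepsize_sq hτrec k
    have h4 : τ (k + 1) ≤ (1 - τ (k + 1) / 2) * τ k := by
      refine (pow_le_pow_iff_left₀ h2.le (mul_nonneg (by linarith) h0.le) two_ne_zero).1 ?_
      rw [hsq]
      nlinarith [mul_nonneg (sq_nonneg (τ (k + 1))) (sq_nonneg (τ k))]
    have hk : (0 : ℝ) ≤ k := k.cast_nonneg
    push_cast
    nlinarith [mul_le_mul_of_nonneg_right h4 (show (0 : ℝ) ≤ k + 2 by linarith),
      mul_le_mul_of_nonneg_left ih (show 0 ≤ 1 - τ (k + 1) / 2 by linarith)]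

end StepSizes

/-- One iteration of the accelerated penalty scheme, in terms of the extrapolated points
`xt, xt', yt, yt'`. -/
theorem penalty_step
    {H1 H2 H : Type*}
    [NormedAddCommGroup H1] [InnerProductSpace ℝ H1] [CompleteSpace H1]
    [NormedAddCommGroup H2] [InnerProductSpace ℝ H2] [CompleteSpace H2]
    [NormedAddCommGroup H] [InnerProductSpace ℝ H] [CompleteSpace H]
    (A : H1 →L[ℝ] H) (B : H2 →L[ℝ] H) (c : H) {K : Set H} {P : H → H}
    (hPmem : ∀ u, P u ∈ K) (hPproj : ∀ u, ∀ w ∈ K, ⟪u - P u, w - P u⟫ ≤ 0)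
    {f : H1 → ℝ} {g : H2 → ℝ} (hg : ConvexOn ℝ Set.univ g) {μ ρ γ t : ℝ} (hρ : 0 ≤ ρ) (hγ : 0 ≤ γ)
    (ht0 : 0 < t) (ht1 : t ≤ 1) {xs : H1} {ys : H2} (hfeas : A xs + B ys - c ∈ K)
    {x x' xt xt' : H1} {y y' yh yt yt' : H2} {ξ : H1} {η : H2}
    (hx' : x' = (1 - t) • x + t • xt') (hyh : yh = (1 - t) • y + t • yt)
    (hy' : y' = (1 - t) • y + t • yt')
    (hξ : ∀ z : H1, f z ≥ f x' + ⟪ξ, z - x'⟫)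
    (hξeq : ξ + ρ • (ContinuousLinearMap.adjoint A
        ((A x' + B yh - c) - P (A x' + B yh - c))) + γ • (x' - ((1 - t) • x + t • xt)) = 0)
    (hη : ∀ z : H2, g z ≥ g yt' + ⟪η, z - yt'⟫ + μ / 2 * ‖z - yt'‖ ^ 2)
    (hηeq : η + ρ • (ContinuousLinearMap.adjoint B
        ((A x' + B yh - c) - P (A x' + B yh - c))) + (t * ρ * ‖B‖ ^ 2) • (yt' - yt) = 0) :
    f x' + g y' + ρ / 2 * ‖(A x' + B y' - c) - P (A x' + B y' - c)‖ ^ 2 ≤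
      (1 - t) * (f x + g y
          + (1 - t) * ρ / 2 * ‖(A x + B y - c) - P (A x + B y - c)‖ ^ 2)
        + t * (f xs + g ys)
        + t ^ 2 * γ / 2 * (‖xt - xs‖ ^ 2 - ‖xt' - xs‖ ^ 2)
        + t ^ 2 * ρ * ‖B‖ ^ 2 / 2 * (‖yt - ys‖ ^ 2 - ‖yt' - ys‖ ^ 2)
        - t * μ / 2 * ‖yt' - ys‖ ^ 2 := by
  have hlow := proj_residual_gradient_lower hPmem hPproj (A x' + B yh - c) (A x + B y - c)
  have hup := proj_residual_gradient_upper hPmem hPproj (A x' + B yh - c) (A x' + B y' - c)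
  have hin := proj_residual_inner_le hPproj (A x' + B yh - c) hfeas
  have hcomb := mul_norm_sq_le_convex_combination t
    ((A x + B y - c) - P (A x + B y - c)) ((A x' + B yh - c) - P (A x' + B yh - c))
  set s := (A x' + B yh - c) - P (A x' + B yh - c) with hs
  have hf1 := hξ x
  have hf2 := hξ xs
  have hg2 := hη ys
  have hgc : g y' ≤ (1 - t) * g y + t * g yt' := by
    rw [hy']
    exact hg.2 (Set.mem_univ _) (Set.mem_univ _) (by linarith) ht0.le (by ring)
  have hξ' : ξ = -(ρ • (ContinuousLinearMap.adjoint A s)) - (γ * t) • (xt' - xt) := by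
    have : x' - ((1 - t) • x + t • xt) = t • (xt' - xt) := by rw [hx']; module
    rw [this, smul_smul] at hξeq
    rw [← sub_eq_zero, ← hξeq]; abel
  have hη' : η = -(ρ • (ContinuousLinearMap.adjoint B s)) - (t * ρ * ‖B‖ ^ 2) • (yt' - yt) := by
    rw [← sub_eq_zero, ← hηeq]; abel
  have hfsum : f x' ≤ (1 - t) * f x + t * f xs + t * ⟪ξ, xt' - xs⟫ := by
    have e : (1 - t) * ⟪ξ, x - x'⟫ + t * ⟪ξ, xs - x'⟫ = -(t * ⟪ξ, xt' - xs⟫) := by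
      rw [← real_inner_smul_right, ← real_inner_smul_right, ← real_inner_smul_right,
        ← inner_add_right, ← inner_neg_right]
      congr 1
      rw [hx']; module
    nlinarith [mul_le_mul_of_nonneg_left hf1 (sub_nonneg.2 ht1),
      mul_le_mul_of_nonneg_left hf2 ht0.le]
  have hBn : ‖(A x' + B y' - c) - (A x' + B yh - c)‖ ^ 2 ≤ ‖B‖ ^ 2 * t ^ 2 * ‖yt' - yt‖ ^ 2 := by
    have e : (A x' + B y' - c) - (A x' + B yh - c) = t • B (yt' - yt) := by
      rw [hy', hyh]; simp only [map_add, map_smul, map_sub]; module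
    rw [e, norm_smul, mul_pow, Real.norm_eq_abs, sq_abs]
    have := pow_le_pow_left₀ (norm_nonneg _) (B.le_opNorm (yt' - yt)) 2
    rw [mul_pow] at this
    nlinarith [sq_nonneg t]
  have hξi : ⟪ξ, xt' - xs⟫ = -(ρ * ⟪s, A (xt' - xs)⟫) - γ * t * ⟪xt' - xt, xt' - xs⟫ := by
    rw [hξ', inner_sub_left, inner_neg_left, real_inner_smul_left, real_inner_smul_left,
      ContinuousLinearMap.adjoint_inner_left]
  have hηi : ⟪η, ys - yt'⟫ =
      ρ * ⟪s, B (yt' - ys)⟫ + t * ρ * ‖B‖ ^ 2 * ⟪yt' - yt, yt' - ys⟫ := by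
    rw [← neg_sub yt' ys, inner_neg_right, hη', inner_sub_left, inner_neg_left,
      real_inner_smul_left, real_inner_smul_left, ContinuousLinearMap.adjoint_inner_left]
    ring
  have hlin : ⟪s, (A x' + B y' - c) - (A x' + B yh - c)⟫ - t * ⟪s, A (xt' - xs)⟫
      - t * ⟪s, B (yt' - ys)⟫ = (1 - t) * ⟪s, (A x + B y - c) - (A x' + B yh - c)⟫
        + t * ⟪s, (A xs + B ys - c) - (A x' + B yh - c)⟫ := by
    simp only [← real_inner_smul_right, ← inner_add_right, ← inner_sub_right]
    congr 1
    have hx'' : A x' = (1 - t) • A x + t • A xt' := by rw [hx']; simp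
    have hy'' : B y' = (1 - t) • B y + t • B yt' := by rw [hy']; simp
    rw [hx'', hy'', map_sub, map_sub]
    module
  have hxi := two_mul_inner_sub_sub xt' xt xs
  have hyi := two_mul_inner_sub_sub yt' yt ys
  rw [norm_sub_rev ys yt', hηi] at hg2
  rw [hξi] at hfsum
  have h1t : 0 ≤ 1 - t := sub_nonneg.2 ht1
  have hq : 0 ≤ γ * t ^ 2 * ‖xt' - xt‖ ^ 2 := by positivity
  linear_combination hfsum + hgc + t * hg2 + ρ / 2 * hup + ρ / 2 * hBn + ρ * hlin
    + ρ * (1 - t) / 2 * hlow + ρ * t * hin + ρ / 2 * hcomb + hq / 2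
    - γ * t ^ 2 / 2 * hxi - t ^ 2 * ρ * ‖B‖ ^ 2 / 2 * hyi

/-- Passage from a penalized-energy estimate to objective and feasibility bounds. -/
theorem penalty_bounds_of_energy {Δ d L R ρ T N : ℝ} (hρ : 0 < ρ) (hT : 0 < T)
    (hN : 0 < N) (hL : 0 ≤ L) (hR : 0 ≤ R) (hTN : T * N ≤ 2)
    (hupper : Δ + ρ / T ^ 2 / 2 * d ^ 2 ≤ T ^ 2 * R / 2) (hlower : -(L * d) ≤ Δ) :
    |Δ| ≤ 2 * max (ρ * R) (2 * L * (L + Real.sqrt (L ^ 2 + ρ * R))) / (ρ * N ^ 2) ∧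
      d ≤ 4 * (L + Real.sqrt (L ^ 2 + ρ * R)) / (ρ * N ^ 2) := by
  set S := L + Real.sqrt (L ^ 2 + ρ * R) with hS
  have hS0 : 0 ≤ S := add_nonneg hL (Real.sqrt_nonneg _)
  have hTN2 : T ^ 2 * N ^ 2 ≤ 4 := by
    nlinarith [mul_pos hT hN]
  have hdS : ρ * d ≤ T ^ 2 * S := by
    have he : ρ * d / T ^ 2 - L ≤ Real.sqrt (L ^ 2 + ρ * R) := by
      apply Real.le_sqrt_of_sq_le
      have h1 : ρ / T ^ 2 / 2 * d ^ 2 - L * d ≤ T ^ 2 * R / 2 := by linarith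
      have h2 : (ρ * d / T ^ 2 - L) ^ 2 - (L ^ 2 + ρ * R) =
          2 * ρ / T ^ 2 * ((ρ / T ^ 2 / 2 * d ^ 2 - L * d) - T ^ 2 * R / 2) := by
        field_simp
        ring
      have h3 : 2 * ρ / T ^ 2 * ((ρ / T ^ 2 / 2 * d ^ 2 - L * d) - T ^ 2 * R / 2) ≤ 0 :=
        mul_nonpos_of_nonneg_of_nonpos (by positivity) (by linarith)
      linarith
    have h4 : ρ * d / T ^ 2 ≤ S := by linarith
    rw [div_le_iff₀ (by positivity)] at h4
    linarith
  have hdN : d * (ρ * N ^ 2) ≤ 4 * S := by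
    calc d * (ρ * N ^ 2) = ρ * d * N ^ 2 := by ring
      _ ≤ T ^ 2 * S * N ^ 2 := by gcongr
      _ = T ^ 2 * N ^ 2 * S := by ring
      _ ≤ 4 * S := by gcongr
  refine ⟨?_, by rwa [le_div_iff₀ (by positivity)]⟩
  have hden : 0 < ρ * N ^ 2 := by positivity
  rw [le_div_iff₀ hden, ← abs_of_pos hden, ← abs_mul, abs_le]
  have hm1 := le_max_left (ρ * R) (2 * L * S)
  have hm2 := le_max_right (ρ * R) (2 * L * S)
  constructor
  · have := mul_le_mul_of_nonneg_right hlower hden.le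
    have := mul_le_mul_of_nonneg_left hdN hL
    linarith
  · have h5 : Δ ≤ T ^ 2 * R / 2 := by
      have : 0 ≤ ρ / T ^ 2 / 2 * d ^ 2 := by positivity
      linarith
    have := mul_le_mul_of_nonneg_right h5 hden.le
    have := mul_le_mul_of_nonneg_right hTN2 (mul_nonneg hρ.le hR)
    linarith

/-- (Theorem 2: convergence of Algorithm 2 / PAPA under semi-strong
convexity, Option 1.) With `τ₀ = 1`, `τ_{k+1} = (τ_k/2)(√(τ_k²+4) − τ_k)`,
`ρ_k = ρ₀/τ_k²`, `ρ₀ ∈ (0, μ_g/(2‖B‖²)]`, and the updates of Algorithm 2, for every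
`k ≥ 1`:
`|F(zᵏ) − F⋆| ≤ 2max{ρ₀R_p², 2‖λ⋆‖R_d}/(ρ₀(k+1)²)` and
`dist_K(A xᵏ + B yᵏ − c) ≤ 4R_d/(ρ₀(k+1)²)`, where
`R_p² = γ₀‖x⁰−x⋆‖² + ρ₀‖B‖²‖y⁰−y⋆‖²` and `R_d = ‖λ⋆‖ + √(‖λ⋆‖² + ρ₀R_p²)`. -/
theorem stmt_13
    {H1 H2 H : Type*}
    [NormedAddCommGroup H1] [InnerProductSpace ℝ H1] [CompleteSpace H1]
    [NormedAddCommGroup H2] [InnerProductSpace ℝ H2] [CompleteSpace H2]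
    [NormedAddCommGroup H] [InnerProductSpace ℝ H] [CompleteSpace H]
    (A : H1 →L[ℝ] H) (B : H2 →L[ℝ] H) (c : H) (K : Set H)
    (hKne : K.Nonempty) (hKcl : IsClosed K) (hKcv : Convex ℝ K)
    (P : H → H) (hPmem : ∀ u, P u ∈ K)
    (hPproj : ∀ u, ∀ w ∈ K, ⟪u - P u, w - P u⟫ ≤ 0)
    (f : H1 → ℝ) (g : H2 → ℝ)
    (hf : ConvexOn ℝ Set.univ f)
    (μ : ℝ) (hμ : 0 < μ)
    (hg : ConvexOn ℝ Set.univ (fun z : H2 => g z - μ/2 * ‖z‖ ^ 2))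
    (hB : B ≠ 0)
    (xs : H1) (ys : H2) (lams : H)
    (hfeas : A xs + B ys - c ∈ K)
    (hsaddle : ∀ (x : H1) (y : H2), ∀ r ∈ K,
      f x + g y - ⟪lams, A x + B y - r - c⟫ ≥ f xs + g ys)
    (ρ0 γ0 : ℝ) (hγ0 : 0 ≤ γ0) (hρ0 : 0 < ρ0) (hρ0' : ρ0 ≤ μ / (2 * ‖B‖ ^ 2))
    (τ : ℕ → ℝ) (hτ0 : τ 0 = 1)
    (hτrec : ∀ k : ℕ, τ (k+1) = τ k / 2 * (Real.sqrt (τ k ^ 2 + 4) - τ k))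
    (x : ℕ → H1) (y : ℕ → H2) (xh : ℕ → H1) (yt : ℕ → H2) (yh : ℕ → H2)
    (hx0 : xh 0 = x 0) (hy0 : yt 0 = y 0)
    (hyh : ∀ k : ℕ, yh k = (1 - τ k) • y k + τ k • yt k)
    (hxsub : ∀ k : ℕ, ∃ ξ : H1,
      (∀ x' : H1, f x' ≥ f (x (k+1)) + ⟪ξ, x' - x (k+1)⟫) ∧
      ξ + (ρ0 / τ k ^ 2) • (ContinuousLinearMap.adjoint A
            ((A (x (k+1)) + B (yh k) - c) - P (A (x (k+1)) + B (yh k) - c)))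
        + γ0 • (x (k+1) - xh k) = 0)
    (hmomx : ∀ k : ℕ,
      xh (k+1) = x (k+1) + (τ (k+1) * (1 - τ k) / τ k) • (x (k+1) - x k))
    (hysub : ∀ k : ℕ, ∃ η : H2,
      (η + (ρ0 / τ k ^ 2) • (ContinuousLinearMap.adjoint B
            ((A (x (k+1)) + B (yh k) - c) - P (A (x (k+1)) + B (yh k) - c)))
        + (τ k * (ρ0 / τ k ^ 2) * ‖B‖ ^ 2) • (yt (k+1) - yt k) = 0) ∧
      (∀ y' : H2, g y' ≥ g (yt (k+1)) + ⟪η, y' - yt (k+1)⟫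
        + (μ/2) * ‖y' - yt (k+1)‖ ^ 2))
    (hyk1 : ∀ k : ℕ, y (k+1) = (1 - τ k) • y k + τ k • yt (k+1)) :
    ∀ k : ℕ, 1 ≤ k →
      |(f (x k) + g (y k)) - (f xs + g ys)| ≤
        2 * max (ρ0 * (γ0 * ‖x 0 - xs‖ ^ 2 + ρ0 * ‖B‖ ^ 2 * ‖y 0 - ys‖ ^ 2))
            (2 * ‖lams‖ * (‖lams‖ + Real.sqrt (‖lams‖ ^ 2
              + ρ0 * (γ0 * ‖x 0 - xs‖ ^ 2 + ρ0 * ‖B‖ ^ 2 * ‖y 0 - ys‖ ^ 2))))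
          / (ρ0 * ((k : ℝ) + 1) ^ 2) ∧
      Metric.infDist (A (x k) + B (y k) - c) K ≤
        4 * (‖lams‖ + Real.sqrt (‖lams‖ ^ 2
            + ρ0 * (γ0 * ‖x 0 - xs‖ ^ 2 + ρ0 * ‖B‖ ^ 2 * ‖y 0 - ys‖ ^ 2)))
          / (ρ0 * ((k : ℝ) + 1) ^ 2) := by
  have hgconv : ConvexOn ℝ Set.univ g :=
    (strongConvexOn_iff_convex.2 hg).convexOn (fun _ => by positivity)
  obtain ⟨xt, hxt0, hxt⟩ : ∃ xt : ℕ → H1, xt 0 = x 0 ∧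
      ∀ k, x (k + 1) = (1 - τ k) • x k + τ k • xt (k + 1) := by
    refine ⟨fun k => Nat.casesOn k (x 0)
      (fun k => (τ k)⁻¹ • (x (k + 1) - (1 - τ k) • x k)), rfl, fun k => ?_⟩
    have := (stepsize_pos_le_one hτ0 hτrec k).1.ne'
    simp only [smul_inv_smul₀ this]
    abel
  have hxh : ∀ k, xh k = (1 - τ k) • x k + τ k • xt k := by
    rintro (_ | k)
    · rw [hx0, hxt0]; module
    · have hne := (stepsize_pos_le_one hτ0 hτrec k).1.ne'
      have e : xt (k + 1) = (τ k)⁻¹ • (x (k + 1) - (1 - τ k) • x k) := by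
        rw [hxt k, add_sub_cancel_left, inv_smul_smul₀ hne]
      rw [hmomx, e]
      match_scalars <;> field_simp <;> ring
  have hBpos : 0 < ‖B‖ := norm_pos_iff.2 hB
  have hρμ : 2 * (ρ0 * ‖B‖ ^ 2) ≤ μ := by
    rw [le_div_iff₀ (by positivity)] at hρ0'
    linarith
  have hstep : ∀ k, f (x (k + 1)) + g (y (k + 1)) + ρ0 / τ k ^ 2 / 2 *
      ‖(A (x (k + 1)) + B (y (k + 1)) - c) - P (A (x (k + 1)) + B (y (k + 1)) - c)‖ ^ 2 ≤
      (1 - τ k) * (f (x k) + g (y k) + (1 - τ k) * (ρ0 / τ k ^ 2) / 2 *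
          ‖(A (x k) + B (y k) - c) - P (A (x k) + B (y k) - c)‖ ^ 2)
        + τ k * (f xs + g ys)
        + τ k ^ 2 * γ0 / 2 * (‖xt k - xs‖ ^ 2 - ‖xt (k + 1) - xs‖ ^ 2)
        + τ k ^ 2 * (ρ0 / τ k ^ 2) * ‖B‖ ^ 2 / 2 *
          (‖yt k - ys‖ ^ 2 - ‖yt (k + 1) - ys‖ ^ 2)
        - τ k * μ / 2 * ‖yt (k + 1) - ys‖ ^ 2 := by
    intro k
    obtain ⟨h0, h1⟩ := stepsize_pos_le_one hτ0 hτrec k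
    obtain ⟨ξ, hξ, hξeq⟩ := hxsub k
    obtain ⟨η, hηeq, hη⟩ := hysub k
    rw [hxh] at hξeq
    exact penalty_step A B c hPmem hPproj hgconv (by positivity) hγ0 h0 h1 hfeas (hxt k)
      (hyh k) (hyk1 k) hξ hξeq hη hηeq
  have henergy : ∀ k, f (x (k + 1)) + g (y (k + 1)) - (f xs + g ys) + ρ0 / τ k ^ 2 / 2 *
      ‖(A (x (k + 1)) + B (y (k + 1)) - c) - P (A (x (k + 1)) + B (y (k + 1)) - c)‖ ^ 2
      + τ k ^ 2 * γ0 / 2 * ‖xt (k + 1) - xs‖ ^ 2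
      + (ρ0 * ‖B‖ ^ 2 + τ k * μ) / 2 * ‖yt (k + 1) - ys‖ ^ 2 ≤
      τ k ^ 2 * (γ0 * ‖x 0 - xs‖ ^ 2 + ρ0 * ‖B‖ ^ 2 * ‖y 0 - ys‖ ^ 2) / 2 := by
    intro k
    induction k with
    | zero =>
      have h := hstep 0
      rw [hxt0, hy0, hτ0] at h
      rw [hτ0]
      linarith
    | succ k ih =>
      have h := hstep (k + 1)
      have h0 := (stepsize_pos_le_one hτ0 hτrec k).1
      obtain ⟨h2, h3⟩ := stepsize_pos_le_one hτ0 hτrec (k + 1)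
      have hsq := stepsize_sq hτrec k
      have hhalf := stepsize_le_two_mul_succ hτ0 hτrec k
      have hr : (1 - τ (k + 1)) * (ρ0 / τ (k + 1) ^ 2) = ρ0 / τ k ^ 2 := by
        rw [← mul_div_assoc, div_eq_div_iff (by positivity) (by positivity), hsq]
        ring
      have hr' : τ (k + 1) ^ 2 * (ρ0 / τ (k + 1) ^ 2) = ρ0 := by field_simp
      rw [hr, hr'] at h
      have hcoef : ρ0 * ‖B‖ ^ 2 ≤ (1 - τ (k + 1)) * (ρ0 * ‖B‖ ^ 2 + τ k * μ) := by
        have h4 : τ (k + 1) * (ρ0 * ‖B‖ ^ 2) * τ k ≤ (1 - τ (k + 1)) * τ k * μ * τ k := by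
          have h5 : ρ0 * ‖B‖ ^ 2 * τ k ≤ μ * τ (k + 1) := by
            have := mul_le_mul_of_nonneg_left hhalf (show 0 ≤ ρ0 * ‖B‖ ^ 2 by positivity)
            have := mul_le_mul_of_nonneg_right hρμ h2.le
            linarith
          have h6 := mul_le_mul_of_nonneg_left h5 h2.le
          have h7 : (1 - τ (k + 1)) * τ k * μ * τ k = μ * τ (k + 1) ^ 2 := by rw [hsq]; ring
          rw [h7]
          linarith
        linarith [le_of_mul_le_mul_right h4 h0]
      have hy := mul_le_mul_of_nonneg_right hcoef (sq_nonneg ‖yt (k + 1) - ys‖)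
      have ih' := mul_le_mul_of_nonneg_left ih (sub_nonneg.2 h3)
      linear_combination h + ih' + hy / 2
        + (γ0 / 2 * ‖xt (k + 1) - xs‖ ^ 2
          - (γ0 * ‖x 0 - xs‖ ^ 2 + ρ0 * ‖B‖ ^ 2 * ‖y 0 - ys‖ ^ 2) / 2) * hsq
  intro k hk
  obtain ⟨k, rfl⟩ := Nat.exists_eq_add_of_le' hk
  have h0 := (stepsize_pos_le_one hτ0 hτrec k).1
  have hTN := stepsize_mul_le_two hτ0 hτrec k
  have hk0 : (0 : ℝ) ≤ k := k.cast_nonneg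
  set w := A (x (k + 1)) + B (y (k + 1)) - c with hw
  have hlower : -(‖lams‖ * ‖w - P w‖) ≤
      f (x (k + 1)) + g (y (k + 1)) - (f xs + g ys) := by
    have h := hsaddle (x (k + 1)) (y (k + 1)) (P w) (hPmem w)
    rw [show A (x (k + 1)) + B (y (k + 1)) - P w - c = w - P w by rw [hw]; abel] at h
    have := (abs_le.1 (abs_real_inner_le_norm lams (w - P w))).1
    linarith
  have hupper : f (x (k + 1)) + g (y (k + 1)) - (f xs + g ys)
      + ρ0 / τ k ^ 2 / 2 * ‖w - P w‖ ^ 2 ≤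
      τ k ^ 2 * (γ0 * ‖x 0 - xs‖ ^ 2 + ρ0 * ‖B‖ ^ 2 * ‖y 0 - ys‖ ^ 2) / 2 := by
    have h := henergy k
    have hx : 0 ≤ τ k ^ 2 * γ0 / 2 * ‖xt (k + 1) - xs‖ ^ 2 := by positivity
    have hy : 0 ≤ (ρ0 * ‖B‖ ^ 2 + τ k * μ) / 2 * ‖yt (k + 1) - ys‖ ^ 2 := by positivity
    linarith
  have hN : ((k + 1 : ℕ) : ℝ) + 1 = k + 2 := by push_cast; ring
  rw [hN]
  obtain ⟨hF, hD⟩ := penalty_bounds_of_energy hρ0 h0 (by linarith) (norm_nonneg lams)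
    (by positivity) hTN hupper hlower
  refine ⟨hF, le_trans ?_ hD⟩
  rw [← dist_eq_norm]
  exact Metric.infDist_le_dist_of_mem (hPmem w)
end
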